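/- Suppose for every k ≥ 0 there exists A_k ∈ ℝ with |A_k| ≤ τ^{kα} and ‖u − A_k x_n‖_{L^∞(Ω ∩ Q^{τ^{kα}}_{τ^k})} ≤ τ^{k(1+α)}, where Q^{ρ}_r = B_r × (−ρ^{−γ} r², 0], 0 < τ < 1/8, 0 < α, γ ≥ 0, and α(1+γ) ≤ 1. Then |u(x,t)| ≤ (2/τ^{1+α})(|x|^{1+α} + |t|^{(1+α)/(2−αγ)}) for all (x,t) ∈ Ω ∩ Q^1_1. -/

import Mathlib

/-- A number in `(0, 1)` lies in one of the half-open geometric shells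
`[τ ^ (k + 1), τ ^ k)`. -/
lemma exists_pow_succ_le_and_lt_pow {τ M : ℝ} (hτ : 0 ≤ τ) (hτ1 : τ < 1) (hM : 0 < M)
    (hM1 : M < 1) : ∃ k : ℕ, τ ^ (k + 1) ≤ M ∧ M < τ ^ k := by
  classical
  have hex : ∃ k : ℕ, τ ^ (k + 1) ≤ M := by
    obtain ⟨m, hm⟩ := exists_pow_lt_of_lt_one hM hτ1
    exact ⟨m, (pow_le_pow_of_le_one hτ hτ1.le m.le_succ).trans hm.le⟩
  refine ⟨Nat.find hex, Nat.find_spec hex, ?_⟩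
  rcases hk : Nat.find hex with _ | m
  · simpa using hM1
  · exact not_le.1 (Nat.find_min hex (m := m) (by omega))

/-- If `a ≤ C (τ ^ k) ^ β` whenever `M < τ ^ k`, then `a ≤ C / τ ^ β * M ^ β`. -/
lemma le_mul_rpow_of_forall_lt_pow {τ M a C β : ℝ} (hτ : 0 < τ) (hτ1 : τ < 1) (hM : 0 ≤ M)
    (hM1 : M < 1) (hC : 0 ≤ C) (hβ : 0 < β)
    (h : ∀ k : ℕ, M < τ ^ k → a ≤ C * (τ ^ k) ^ β) : a ≤ C / τ ^ β * M ^ β := by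
  rcases hM.eq_or_lt with rfl | hM0
  · have hlim : Filter.Tendsto (fun k : ℕ => C * (τ ^ k) ^ β) Filter.atTop
        (nhds (C * (0 : ℝ) ^ β)) :=
      ((tendsto_pow_atTop_nhds_zero_of_lt_one hτ.le hτ1).rpow_const (Or.inr hβ.le)).const_mul C
    have ha : a ≤ C * (0 : ℝ) ^ β := ge_of_tendsto' hlim fun k => h k (pow_pos hτ k)
    simpa [Real.zero_rpow hβ.ne'] using ha
  · obtain ⟨k, hk, hk'⟩ := exists_pow_succ_le_and_lt_pow hτ.le hτ1 hM0 hM1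
    calc a ≤ C * (τ ^ k) ^ β := h k hk'
      _ ≤ C * (M / τ) ^ β := by
        gcongr
        rw [le_div_iff₀ hτ, ← pow_succ]
        exact hk
      _ = C / τ ^ β * M ^ β := by
        rw [Real.div_rpow hM hτ.le]
        ring

/-- Pointwise-regularity conclusion step: if for every `k ≥ 0` there is `A_k` with
`|A_k| ≤ τ^{kα}` and `‖u - A_k x_n‖_{L^∞(Ω ∩ Q^{τ^{kα}}_{τ^k})} ≤ τ^{k(1+α)}`, where
`Q^ρ_r = B_r × (-ρ^{-γ}r², 0]`, then
`|u(x,t)| ≤ (2/τ^{1+α})(|x|^{1+α} + |t|^{(1+α)/(2-αγ)})` on `Ω ∩ Q^1_1`.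
Points live in `ℝ^{n+1}` with `x_{n+1}` the last coordinate. -/
theorem stmt_13 {n : ℕ} (u : (Fin (n + 1) → ℝ) → ℝ → ℝ)
    (Ω : Set ((Fin (n + 1) → ℝ) × ℝ)) (τ α γ : ℝ)
    (hτ : 0 < τ) (hτ' : τ < 1 / 8) (hα : 0 < α) (hγ : 0 ≤ γ)
    (hαγ : α * (1 + γ) ≤ 1)
    (h : ∀ k : ℕ, ∃ A : ℝ, |A| ≤ τ ^ ((k : ℝ) * α) ∧
      ∀ q ∈ Ω, (∑ j, (q.1 j) ^ 2) < (τ ^ (k : ℝ)) ^ 2 →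
        -((τ ^ ((k : ℝ) * α)) ^ (-γ) * (τ ^ (k : ℝ)) ^ 2) < q.2 → q.2 ≤ 0 →
        |u q.1 q.2 - A * q.1 (Fin.last n)| ≤ τ ^ ((k : ℝ) * (1 + α))) :
    ∀ q ∈ Ω, (∑ j, (q.1 j) ^ 2) < 1 → -1 < q.2 → q.2 ≤ 0 →
      |u q.1 q.2| ≤ (2 / τ ^ (1 + α)) *
        ((Real.sqrt (∑ j, (q.1 j) ^ 2)) ^ (1 + α) +
          |q.2| ^ ((1 + α) / (2 - α * γ))) := by
  intro q hq hx ht ht0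
  have hp : 0 < 2 - α * γ := by nlinarith
  have hβ : 0 < 1 + α := by linarith
  set S := ∑ j, (q.1 j) ^ 2
  set r := Real.sqrt S
  set s := |q.2| ^ (1 / (2 - α * γ)) with hs
  have hr0 : 0 ≤ r := Real.sqrt_nonneg _
  have hs0 : 0 ≤ s := by positivity
  have hr1 : r < 1 := (Real.sqrt_lt' one_pos).2 (by simpa using hx)
  have ht1 : |q.2| < 1 := by
    rw [abs_of_nonpos ht0]
    linarith
  have hs1 : s < 1 := Real.rpow_lt_one (abs_nonneg _) ht1 (by positivity)
  have hsp : s ^ (2 - α * γ) = |q.2| := by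
    rw [hs, ← Real.rpow_mul (abs_nonneg _), one_div_mul_cancel hp.ne', Real.rpow_one]
  have hsβ : s ^ (1 + α) = |q.2| ^ ((1 + α) / (2 - α * γ)) := by
    rw [hs, ← Real.rpow_mul (abs_nonneg _)]
    congr 1
    ring
  have hlast : |q.1 (Fin.last n)| ≤ r := by
    refine Real.abs_le_sqrt ?_
    exact Finset.single_le_sum (f := fun j => (q.1 j) ^ 2) (fun j _ => sq_nonneg _)
      (Finset.mem_univ _)
  have key : ∀ k : ℕ, max r s < τ ^ k → |u q.1 q.2| ≤ 2 * (τ ^ k) ^ (1 + α) := by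
    intro k hk
    obtain ⟨hrk, hsk⟩ := max_lt_iff.1 hk
    have hR : 0 < τ ^ k := pow_pos hτ k
    have hpow : ∀ b : ℝ, τ ^ ((k : ℝ) * b) = (τ ^ k) ^ b := fun b => by
      rw [Real.rpow_mul hτ.le, Real.rpow_natCast]
    obtain ⟨A, hA, hu⟩ := h k
    have hheight : ((τ ^ k) ^ α) ^ (-γ) * (τ ^ k) ^ 2 = (τ ^ k) ^ (2 - α * γ) := by
      rw [← Real.rpow_mul hR.le, ← Real.rpow_natCast (τ ^ k) 2, ← Real.rpow_add hR]
      congr 1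
      push_cast
      ring
    have htk : |q.2| < (τ ^ k) ^ (2 - α * γ) := by
      rw [← hsp]
      exact Real.rpow_lt_rpow hs0 hsk hp
    rw [hpow] at hA
    have happ := hu q hq (by
      rw [Real.rpow_natCast]
      exact (Real.sqrt_lt' hR).1 hrk) (by
      rw [hpow, Real.rpow_natCast, hheight]
      exact neg_lt_of_abs_lt htk) ht0
    rw [hpow] at happ
    have hAx : |A * q.1 (Fin.last n)| ≤ (τ ^ k) ^ (1 + α) := by
      rw [abs_mul, add_comm 1 α, Real.rpow_add_one hR.ne']
      exact mul_le_mul hA (hlast.trans hrk.le) (abs_nonneg _) (by positivity)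
    have htri := abs_add_le (u q.1 q.2 - A * q.1 (Fin.last n)) (A * q.1 (Fin.last n))
    rw [sub_add_cancel] at htri
    linarith
  refine (le_mul_rpow_of_forall_lt_pow hτ (by linarith) (le_max_of_le_left hr0)
    (max_lt hr1 hs1) zero_le_two hβ key).trans ?_
  rw [← hsβ]
  gcongr
  rcases max_choice r s with hm | hm <;> rw [hm]
  · exact le_add_of_nonneg_right (by positivity)
  · exact le_add_of_nonneg_left (by positivity)
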